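/- arXiv:2511.12023 — 2 statements merged into one kernel-verified Lean document; each statement's English description precedes it below -/
import Mathlib

section
/- For all $0 \le s \le t$ one has $\int_s^t K_H(t,u)^2\,du \le (t-s)^{2H}$. -/
open MeasureTheory Set

/-- The Euler Beta function `B(x,y) = Γ(x)Γ(y)/Γ(x+y)`. -/
noncomputable def eulerBeta (x y : ℝ) : ℝ := Real.Gamma x * Real.Gamma y / Real.Gamma (x + y)

/-- The normalizing constant `c_H = √(H(2H-1)/B(2-2H, H-1/2))`. -/
noncomputable def cH (H : ℝ) : ℝ :=
  Real.sqrt (H * (2*H - 1) / eulerBeta (2 - 2*H) (H - 1/2))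

/-- The fractional Brownian motion kernel:
`K_H(t,s) = c_H s^(1/2-H) ∫_s^t (u-s)^(H-3/2) u^(H-1/2) du` for `0 < s < t`, and `0` otherwise. -/
noncomputable def KH (H : ℝ) (t s : ℝ) : ℝ :=
  if 0 < s ∧ s < t then
    cH H * s ^ ((1:ℝ)/2 - H) * ∫ u in s..t, (u - s) ^ (H - 3/2) * u ^ (H - 1/2)
  else 0

open scoped ENNReal

lemma rpow_kernel_identity {a u v w D E M : ℝ} (hu : 0 < u) (hv : 0 < v) (hw : 0 < w)
    (hD : 0 < D) (hE : 0 < E) (hM : 0 < M) :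
    u ^ (-(2 * a)) * M ^ (a - 1) * E ^ (a - 1) =
      D ^ (2 * a - 1) * v ^ (-a) * w ^ (-a) * (D * w / (v * E ^ 2) *
        ((u * D / (v * E)) ^ (-(2 * a)) * (w * M / (v * E)) ^ (a - 1))) := by
  obtain ⟨u, rfl⟩ : ∃ x, Real.exp x = u := ⟨_, Real.exp_log hu⟩
  obtain ⟨v, rfl⟩ : ∃ x, Real.exp x = v := ⟨_, Real.exp_log hv⟩
  obtain ⟨w, rfl⟩ : ∃ x, Real.exp x = w := ⟨_, Real.exp_log hw⟩
  obtain ⟨D, rfl⟩ : ∃ x, Real.exp x = D := ⟨_, Real.exp_log hD⟩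
  obtain ⟨E, rfl⟩ : ∃ x, Real.exp x = E := ⟨_, Real.exp_log hE⟩
  obtain ⟨M, rfl⟩ : ∃ x, Real.exp x = M := ⟨_, Real.exp_log hM⟩
  simp only [pow_two, ← Real.exp_add, ← Real.exp_sub, ← Real.exp_mul]
  congr 1
  ring

lemma eulerBeta_pos {x y : ℝ} (hx : 0 < x) (hy : 0 < y) : 0 < eulerBeta x y :=
  ProbabilityTheory.beta_pos hx hy

lemma lintegral_beta_kernel_le {a v w : ℝ} (ha : 0 < a) (ha' : a < 1 / 2) (hv : 0 < v)
    (hvw : v < w) :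
    ∫⁻ u in Ioo 0 v, ENNReal.ofReal (u ^ (-(2 * a)) * (v - u) ^ (a - 1) * (w - u) ^ (a - 1)) ≤
      ENNReal.ofReal (eulerBeta (1 - 2 * a) a * ((w - v) ^ (2 * a - 1) * v ^ (-a) * w ^ (-a))) := by
  set B := eulerBeta (1 - 2 * a) a
  have hB0 : 0 < B := eulerBeta_pos (by linarith) ha
  have hw : 0 < w := hv.trans hvw
  have hD : 0 < w - v := sub_pos.2 hvw
  set C := B * ((w - v) ^ (2 * a - 1) * v ^ (-a) * w ^ (-a)) with hC
  have hC0 : 0 ≤ C := by positivity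
  set f : ℝ → ℝ := fun u => u * (w - v) / (v * (w - u)) with hf
  set f' : ℝ → ℝ := fun u => (w - v) * w / (v * (w - u) ^ 2) with hf'
  set g : ℝ → ℝ≥0∞ := fun x =>
    ENNReal.ofReal (1 / B * x ^ ((1 - 2 * a) - 1) * (1 - x) ^ (a - 1)) with hg
  have hg1 : ∫⁻ x in Ioo (0 : ℝ) 1, g x = 1 := by
    rw [← ProbabilityTheory.lintegral_betaPDF_eq_one (α := 1 - 2 * a) (β := a) (by linarith) ha,
      ProbabilityTheory.lintegral_betaPDF]
    rfl
  have h1sub : ∀ u ∈ Ioo 0 v, 1 - f u = w * (v - u) / (v * (w - u)) := by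
    intro u hu
    have : w - u ≠ 0 := by linarith [hu.2]
    simp only [hf]
    field_simp
    ring
  have hderiv : ∀ u ∈ Ioo 0 v, HasDerivWithinAt f (f' u) (Ioo 0 v) u := by
    intro u hu
    have hne : w - u ≠ 0 := by linarith [hu.2]
    have h1 : HasDerivAt (fun u : ℝ => u * (w - v)) (1 * (w - v)) u :=
      (hasDerivAt_id u).mul_const _
    have h2 : HasDerivAt (fun u : ℝ => v * (w - u)) (v * (-1)) u :=
      ((hasDerivAt_id u).const_sub w).const_mul v
    have h3 := h1.div h2 (mul_ne_zero hv.ne' hne)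
    refine HasDerivAt.hasDerivWithinAt ?_
    refine h3.congr_deriv ?_
    simp only [hf']
    field_simp
    ring
  have hinj : InjOn f (Ioo 0 v) := by
    intro x hx y hy hxy
    have hx' : w - x ≠ 0 := by linarith [hx.2]
    have hy' : w - y ≠ 0 := by linarith [hy.2]
    simp only [hf] at hxy
    rw [div_eq_div_iff (mul_ne_zero hv.ne' hx') (mul_ne_zero hv.ne' hy')] at hxy
    have : ((w - v) * v * w) * (x - y) = 0 := by linear_combination hxy
    rcases mul_eq_zero.1 this with h | h
    · exact absurd h (by positivity)
    · linarith
  have himg : f '' Ioo 0 v ⊆ Ioo 0 1 := by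
    rintro _ ⟨u, hu, rfl⟩
    have hE : 0 < w - u := by linarith [hu.2]
    have hM : 0 < v - u := by linarith [hu.2]
    have hu0 := hu.1
    refine ⟨by simp only [hf]; positivity, ?_⟩
    have : 0 < 1 - f u := by rw [h1sub u hu]; positivity
    linarith
  calc ∫⁻ u in Ioo 0 v, ENNReal.ofReal (u ^ (-(2 * a)) * (v - u) ^ (a - 1) * (w - u) ^ (a - 1))
      = ∫⁻ u in Ioo 0 v, ENNReal.ofReal C * (ENNReal.ofReal |f' u| * g (f u)) := by
        refine setLIntegral_congr_fun measurableSet_Ioo fun u hu => ?_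
        have hE : 0 < w - u := by linarith [hu.2]
        have hM : 0 < v - u := by linarith [hu.2]
        have hu0 := hu.1
        have hf'0 : 0 ≤ f' u := by simp only [hf']; positivity
        simp only [hg]
        rw [abs_of_nonneg hf'0, ← ENNReal.ofReal_mul hf'0, ← ENNReal.ofReal_mul hC0, h1sub u hu,
          rpow_kernel_identity hu0 hv hw hD hE hM]
        congr 1
        simp only [hC, hf, hf', show 1 - 2 * a - 1 = -(2 * a) by ring]
        field_simp
    _ = ENNReal.ofReal C * ∫⁻ x in f '' Ioo 0 v, g x := by
        rw [lintegral_const_mul' _ _ ENNReal.ofReal_ne_top,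
          lintegral_image_eq_lintegral_abs_deriv_mul measurableSet_Ioo hderiv hinj]
    _ ≤ ENNReal.ofReal C * ∫⁻ x in Ioo 0 1, g x := by
        gcongr
    _ = ENNReal.ofReal C := by rw [hg1, mul_one]

lemma ofReal_setIntegral_le_lintegral {f : ℝ → ℝ} {s : Set ℝ} (hs : MeasurableSet s)
    (hf : ∀ x ∈ s, 0 ≤ f x) :
    ENNReal.ofReal (∫ x in s, f x) ≤ ∫⁻ x in s, ENNReal.ofReal (f x) := by
  by_cases h : Integrable f (volume.restrict s)
  · exact (ofReal_integral_eq_lintegral_ofReal h (ae_restrict_of_forall_mem hs hf)).le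
  · simp [integral_undef h]

lemma setLIntegral_rpow_sub_right {p s v : ℝ} (hp : -1 < p) (hsv : s ≤ v) :
    ∫⁻ w in Ioo s v, ENNReal.ofReal ((v - w) ^ p) =
      ENNReal.ofReal ((v - s) ^ (p + 1) / (p + 1)) := by
  have hi : IntervalIntegrable (fun w => (v - w) ^ p) volume s v := by
    have := (intervalIntegral.intervalIntegrable_rpow' (a := v - s) (b := 0) hp).comp_sub_left v
    simpa using this
  rw [← ofReal_integral_eq_lintegral_ofReal]
  · rw [← integral_Ioc_eq_integral_Ioo, ← intervalIntegral.integral_of_le hsv,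
      intervalIntegral.integral_comp_sub_left (fun x => x ^ p), integral_rpow (Or.inl hp)]
    simp [Real.zero_rpow (by linarith : p + 1 ≠ 0)]
  · exact ((intervalIntegrable_iff_integrableOn_Ioc_of_le hsv).1 hi).mono_set Ioo_subset_Ioc_self
  · exact ae_restrict_of_forall_mem measurableSet_Ioo
      fun w hw => Real.rpow_nonneg (sub_nonneg.2 hw.2.le) _

lemma setLIntegral_rpow_sub_left {p v t : ℝ} (hp : -1 < p) (hvt : v ≤ t) :
    ∫⁻ w in Ioo v t, ENNReal.ofReal ((w - v) ^ p) =
      ENNReal.ofReal ((t - v) ^ (p + 1) / (p + 1)) := by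
  have hi : IntervalIntegrable (fun w => (w - v) ^ p) volume v t := by
    have := (intervalIntegral.intervalIntegrable_rpow' (a := 0) (b := t - v) hp).comp_sub_right v
    simpa using this
  rw [← ofReal_integral_eq_lintegral_ofReal]
  · rw [← integral_Ioc_eq_integral_Ioo, ← intervalIntegral.integral_of_le hvt,
      intervalIntegral.integral_comp_sub_right (fun x => x ^ p), integral_rpow (Or.inl hp)]
    simp [Real.zero_rpow (by linarith : p + 1 ≠ 0)]
  · exact ((intervalIntegrable_iff_integrableOn_Ioc_of_le hvt).1 hi).mono_set Ioo_subset_Ioc_self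
  · exact ae_restrict_of_forall_mem measurableSet_Ioo
      fun w hw => Real.rpow_nonneg (sub_nonneg.2 hw.1.le) _

lemma lintegral_lintegral_abs_sub_rpow_le {p s t : ℝ} (hp : -1 < p) (hst : s ≤ t) :
    ∫⁻ v in Ioo s t, ∫⁻ w in Ioo s t, ENNReal.ofReal (|v - w| ^ p) ≤
      ENNReal.ofReal (2 * (t - s) ^ (p + 2) / ((p + 1) * (p + 2))) := by
  have hp1 : 0 < p + 1 := by linarith
  have hts : 0 ≤ t - s := sub_nonneg.2 hst
  have hinner : ∀ v ∈ Ioo s t, ∫⁻ w in Ioo s t, ENNReal.ofReal (|v - w| ^ p) ≤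
      ENNReal.ofReal (1 / (p + 1)) *
        (ENNReal.ofReal ((v - s) ^ (p + 1)) + ENNReal.ofReal ((t - v) ^ (p + 1))) := by
    intro v hv
    have hsub : Ioo s t ⊆ (Ioo s v ∪ Ioo v t) ∪ {v} := by
      intro w hw
      rcases lt_trichotomy w v with h | h | h
      · exact Or.inl (Or.inl ⟨hw.1, h⟩)
      · exact Or.inr h
      · exact Or.inl (Or.inr ⟨h, hw.2⟩)
    calc ∫⁻ w in Ioo s t, ENNReal.ofReal (|v - w| ^ p)
        ≤ ∫⁻ w in (Ioo s v ∪ Ioo v t) ∪ {v}, ENNReal.ofReal (|v - w| ^ p) :=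
          lintegral_mono_set hsub
      _ ≤ (∫⁻ w in Ioo s v, ENNReal.ofReal (|v - w| ^ p)) +
            (∫⁻ w in Ioo v t, ENNReal.ofReal (|v - w| ^ p)) +
            ∫⁻ w in {v}, ENNReal.ofReal (|v - w| ^ p) :=
          (lintegral_union_le _ _ _).trans (add_le_add_left (lintegral_union_le _ _ _) _)
      _ = (∫⁻ w in Ioo s v, ENNReal.ofReal ((v - w) ^ p)) +
            (∫⁻ w in Ioo v t, ENNReal.ofReal ((w - v) ^ p)) := by
          rw [setLIntegral_measure_zero {v} _ (by simp), add_zero]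
          congr 1
          · exact setLIntegral_congr_fun measurableSet_Ioo fun w hw => by
              simp only [abs_of_pos (sub_pos.2 hw.2)]
          · exact setLIntegral_congr_fun measurableSet_Ioo fun w hw => by
              simp only [abs_sub_comm v w, abs_of_pos (sub_pos.2 hw.1)]
      _ = _ := by
          rw [setLIntegral_rpow_sub_right hp hv.1.le, setLIntegral_rpow_sub_left hp hv.2.le,
            mul_add, ← ENNReal.ofReal_mul (by positivity), ← ENNReal.ofReal_mul (by positivity)]
          congr 2 <;> ring
  calc ∫⁻ v in Ioo s t, ∫⁻ w in Ioo s t, ENNReal.ofReal (|v - w| ^ p)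
      ≤ ∫⁻ v in Ioo s t, ENNReal.ofReal (1 / (p + 1)) *
        (ENNReal.ofReal ((v - s) ^ (p + 1)) + ENNReal.ofReal ((t - v) ^ (p + 1))) :=
        setLIntegral_mono' measurableSet_Ioo hinner
    _ = ENNReal.ofReal (1 / (p + 1)) * (ENNReal.ofReal ((t - s) ^ (p + 1 + 1) / (p + 1 + 1)) +
          ENNReal.ofReal ((t - s) ^ (p + 1 + 1) / (p + 1 + 1))) := by
        rw [lintegral_const_mul' _ _ ENNReal.ofReal_ne_top, lintegral_add_left (by fun_prop),
          setLIntegral_rpow_sub_left (by linarith) hst,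
          setLIntegral_rpow_sub_right (by linarith) hst]
    _ = _ := by
        have : 0 ≤ (t - s) ^ (p + 1 + 1) / (p + 1 + 1) :=
          div_nonneg (Real.rpow_nonneg hts _) (by linarith)
        rw [← ENNReal.ofReal_add this this, ← ENNReal.ofReal_mul (by positivity)]
        congr 1
        rw [show p + 1 + 1 = p + 2 by ring]
        have : p + 2 ≠ 0 := by linarith
        field_simp
        ring

/-- The integrand `(v - u)^(a-1) v^a` of the fractional kernel, extended by `0` to `v ≤ u`. -/
noncomputable def kernelDensity (a u v : ℝ) : ℝ≥0∞ :=
  if u < v then ENNReal.ofReal ((v - u) ^ (a - 1) * v ^ a) else 0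

lemma measurable_kernelDensity (a : ℝ) :
    Measurable fun x : ℝ × ℝ => kernelDensity a x.1 x.2 :=
  Measurable.ite (measurableSet_lt measurable_fst measurable_snd) (by fun_prop) measurable_const

lemma setLIntegral_kernelDensity_mul_le_of_lt {a s t v w : ℝ} (ha : 0 < a) (ha' : a < 1 / 2)
    (hs : 0 ≤ s) (hv : s < v) (hvw : v < w) :
    ∫⁻ u in Ioo s t,
        ENNReal.ofReal (u ^ (-(2 * a))) * (kernelDensity a u v * kernelDensity a u w) ≤
      ENNReal.ofReal (eulerBeta (1 - 2 * a) a) * ENNReal.ofReal (|v - w| ^ (2 * a - 1)) := by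
  have hv0 : 0 < v := hs.trans_lt hv
  have hw0 : 0 < w := hv0.trans hvw
  have hB0 := eulerBeta_pos (x := 1 - 2 * a) (by linarith) ha
  have hvw0 : 0 ≤ v ^ a * w ^ a := by positivity
  calc ∫⁻ u in Ioo s t,
        ENNReal.ofReal (u ^ (-(2 * a))) * (kernelDensity a u v * kernelDensity a u w)
      ≤ ∫⁻ u in Ioi 0,
        ENNReal.ofReal (u ^ (-(2 * a))) * (kernelDensity a u v * kernelDensity a u w) :=
        lintegral_mono_set fun u hu => hs.trans_lt hu.1
    _ ≤ ∫⁻ u in Ioi 0, (Ioo 0 v).indicator (fun u => ENNReal.ofReal (v ^ a * w ^ a) *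
          ENNReal.ofReal (u ^ (-(2 * a)) * (v - u) ^ (a - 1) * (w - u) ^ (a - 1))) u := by
        refine setLIntegral_mono' measurableSet_Ioi fun u hu => ?_
        have hu : 0 < u := hu
        by_cases huv : u < v
        · have hM : 0 < v - u := sub_pos.2 huv
          have hE : 0 < w - u := by linarith
          rw [indicator_of_mem (show u ∈ Ioo 0 v from ⟨hu, huv⟩), kernelDensity, kernelDensity,
            if_pos huv, if_pos (huv.trans hvw), ← ENNReal.ofReal_mul (by positivity),
            ← ENNReal.ofReal_mul (by positivity), ← ENNReal.ofReal_mul (by positivity)]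
          exact (congrArg _ (by ring)).le
        · simp [kernelDensity, huv]
    _ ≤ ∫⁻ u in Ioo 0 v, ENNReal.ofReal (v ^ a * w ^ a) *
          ENNReal.ofReal (u ^ (-(2 * a)) * (v - u) ^ (a - 1) * (w - u) ^ (a - 1)) := by
        rw [← lintegral_indicator measurableSet_Ioo]
        exact setLIntegral_le_lintegral _ _
    _ ≤ ENNReal.ofReal (v ^ a * w ^ a) * ENNReal.ofReal (eulerBeta (1 - 2 * a) a *
          ((w - v) ^ (2 * a - 1) * v ^ (-a) * w ^ (-a))) := by
        rw [lintegral_const_mul' _ _ ENNReal.ofReal_ne_top]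
        gcongr
        exact lintegral_beta_kernel_le ha ha' hv0 hvw
    _ = _ := by
        rw [← ENNReal.ofReal_mul hvw0, ← ENNReal.ofReal_mul hB0.le, abs_sub_comm,
          abs_of_pos (sub_pos.2 hvw), Real.rpow_neg hv0.le, Real.rpow_neg hw0.le]
        congr 1
        field_simp

lemma setLIntegral_kernelDensity_mul_le {a s t v w : ℝ} (ha : 0 < a) (ha' : a < 1 / 2)
    (hs : 0 ≤ s) (hv : s < v) (hw : s < w) (hvw : v ≠ w) :
    ∫⁻ u in Ioo s t,
        ENNReal.ofReal (u ^ (-(2 * a))) * (kernelDensity a u v * kernelDensity a u w) ≤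
      ENNReal.ofReal (eulerBeta (1 - 2 * a) a) * ENNReal.ofReal (|v - w| ^ (2 * a - 1)) := by
  rcases hvw.lt_or_gt with h | h
  · exact setLIntegral_kernelDensity_mul_le_of_lt ha ha' hs hv h
  · simp_rw [mul_comm (kernelDensity a _ v), abs_sub_comm v w]
    exact setLIntegral_kernelDensity_mul_le_of_lt ha ha' hs hw h

lemma lintegral_mul_sq_lintegral {α β : Type*} [MeasurableSpace α] [MeasurableSpace β]
    {μ : Measure α} {ν : Measure β} [SFinite μ] [SFinite ν] {f : α → ℝ≥0∞} {G : α → β → ℝ≥0∞}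
    (hf : Measurable f) (hG : Measurable (Function.uncurry G)) :
    ∫⁻ u, f u * (∫⁻ v, G u v ∂ν) ^ 2 ∂μ =
      ∫⁻ v, ∫⁻ w, ∫⁻ u, f u * (G u v * G u w) ∂μ ∂ν ∂ν := by
  have hGu : ∀ u, Measurable (G u) := fun u => hG.comp (measurable_const.prodMk measurable_id)
  have hG3 : Measurable fun x : (α × β) × β => f x.1.1 * (G x.1.1 x.1.2 * G x.1.1 x.2) :=
    (hf.comp (measurable_fst.comp measurable_fst)).mul
      ((hG.comp measurable_fst).mul
        (hG.comp ((measurable_fst.comp measurable_fst).prodMk measurable_snd)))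
  calc ∫⁻ u, f u * (∫⁻ v, G u v ∂ν) ^ 2 ∂μ
      = ∫⁻ u, ∫⁻ v, ∫⁻ w, f u * (G u v * G u w) ∂ν ∂ν ∂μ := by
        refine lintegral_congr fun u => ?_
        have h : ∀ v, ∫⁻ w, f u * (G u v * G u w) ∂ν = f u * (G u v * ∫⁻ w, G u w ∂ν) :=
          fun v => by
            rw [lintegral_const_mul _ ((hGu u).const_mul _), lintegral_const_mul _ (hGu u)]
        rw [lintegral_congr h, lintegral_const_mul _ ((hGu u).mul_const _), lintegral_mul_const _ (hGu u), pow_two]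
    _ = ∫⁻ v, ∫⁻ u, ∫⁻ w, f u * (G u v * G u w) ∂ν ∂μ ∂ν :=
        lintegral_lintegral_swap (hG3.lintegral_prod_right').aemeasurable
    _ = _ := by
        refine lintegral_congr fun v => lintegral_lintegral_swap ?_
        exact (hG3.comp ((measurable_fst.prodMk measurable_const).prodMk
          measurable_snd)).aemeasurable

lemma ofReal_KH_sq_le {H s t u : ℝ} (hs : 0 ≤ s) (hu : u ∈ Ioo s t) :
    ENNReal.ofReal (KH H t u ^ 2) ≤ ENNReal.ofReal (cH H ^ 2) *
      (ENNReal.ofReal (u ^ (-(2 * (H - 1 / 2)))) *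
        (∫⁻ v in Ioo s t, kernelDensity (H - 1 / 2) u v) ^ 2) := by
  have hu0 : 0 < u := hs.trans_lt hu.1
  have hI0 : ∀ v ∈ Ioo u t, 0 ≤ (v - u) ^ (H - 3 / 2) * v ^ (H - 1 / 2) := fun v hv =>
    mul_nonneg (Real.rpow_nonneg (sub_nonneg.2 hv.1.le) _)
      (Real.rpow_nonneg (hu0.trans hv.1).le _)
  have hle : ENNReal.ofReal (∫ v in u..t, (v - u) ^ (H - 3 / 2) * v ^ (H - 1 / 2)) ≤
      ∫⁻ v in Ioo s t, kernelDensity (H - 1 / 2) u v := by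
    rw [intervalIntegral.integral_of_le hu.2.le, integral_Ioc_eq_integral_Ioo]
    refine (ofReal_setIntegral_le_lintegral measurableSet_Ioo hI0).trans ?_
    refine le_trans (le_of_eq ?_) (lintegral_mono_set (Ioo_subset_Ioo_left hu.1.le))
    refine setLIntegral_congr_fun measurableSet_Ioo fun v hv => ?_
    simp only [kernelDensity, if_pos hv.1]
    rw [show H - 1 / 2 - 1 = H - 3 / 2 by ring]
  have hnn : 0 ≤ ∫ v in u..t, (v - u) ^ (H - 3 / 2) * v ^ (H - 1 / 2) := by
    rw [intervalIntegral.integral_of_le hu.2.le, integral_Ioc_eq_integral_Ioo]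
    exact setIntegral_nonneg measurableSet_Ioo hI0
  rw [KH, if_pos ⟨hu0, hu.2⟩, mul_pow, mul_pow, mul_assoc, ENNReal.ofReal_mul (by positivity),
    ENNReal.ofReal_mul (by positivity), ENNReal.ofReal_pow hnn, ← Real.rpow_mul_natCast hu0.le,
    show (1 / 2 - H) * ((2 : ℕ) : ℝ) = -(2 * (H - 1 / 2)) by push_cast; ring]
  gcongr

/-- For `0 ≤ s ≤ t`, one has `∫_s^t K_H(t,u)² du ≤ (t-s)^(2H)`. -/
theorem stmt_9 (H : ℝ) (hH : H ∈ Set.Ioo (1/2 : ℝ) 1) (s t : ℝ) (hs : 0 ≤ s) (hst : s ≤ t) :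
    ∫ u in s..t, (KH H t u)^2 ≤ (t - s) ^ (2*H) := by
  obtain ⟨hH1, hH2⟩ := hH
  set a := H - 1 / 2 with ha_def
  have ha : 0 < a := sub_pos.2 hH1
  have ha' : a < 1 / 2 := by linarith
  have hB0 := eulerBeta_pos (x := 1 - 2 * a) (by linarith) ha
  have hts : 0 ≤ t - s := sub_nonneg.2 hst
  have hc : cH H ^ 2 * eulerBeta (1 - 2 * a) a = H * (2 * H - 1) := by
    have hB : eulerBeta (2 - 2 * H) (H - 1 / 2) = eulerBeta (1 - 2 * a) a := by
      rw [show 1 - 2 * a = 2 - 2 * H by ring]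
    rw [cH, hB, Real.sq_sqrt]
    · field_simp
    · exact div_nonneg (mul_nonneg (by linarith) (by linarith)) hB0.le
  rw [intervalIntegral.integral_of_le hst, integral_Ioc_eq_integral_Ioo,
    ← ENNReal.ofReal_le_ofReal_iff (by positivity)]
  calc ENNReal.ofReal (∫ u in Ioo s t, KH H t u ^ 2)
      ≤ ∫⁻ u in Ioo s t, ENNReal.ofReal (KH H t u ^ 2) :=
        ofReal_setIntegral_le_lintegral measurableSet_Ioo fun _ _ => sq_nonneg _
    _ ≤ ∫⁻ u in Ioo s t, ENNReal.ofReal (cH H ^ 2) * (ENNReal.ofReal (u ^ (-(2 * a))) *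
          (∫⁻ v in Ioo s t, kernelDensity a u v) ^ 2) :=
        setLIntegral_mono' measurableSet_Ioo fun u hu => ofReal_KH_sq_le hs hu
    _ = ENNReal.ofReal (cH H ^ 2) * ∫⁻ v in Ioo s t, ∫⁻ w in Ioo s t, ∫⁻ u in Ioo s t,
          ENNReal.ofReal (u ^ (-(2 * a))) * (kernelDensity a u v * kernelDensity a u w) := by
        rw [lintegral_const_mul' _ _ ENNReal.ofReal_ne_top,
          lintegral_mul_sq_lintegral (by fun_prop) (measurable_kernelDensity a)]
    _ ≤ ENNReal.ofReal (cH H ^ 2) * ∫⁻ v in Ioo s t, ∫⁻ w in Ioo s t,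
          ENNReal.ofReal (eulerBeta (1 - 2 * a) a) * ENNReal.ofReal (|v - w| ^ (2 * a - 1)) := by
        gcongr 1
        refine setLIntegral_mono' measurableSet_Ioo fun v hv => lintegral_mono_ae ?_
        filter_upwards [ae_restrict_mem measurableSet_Ioo,
          ae_restrict_of_ae (Measure.ae_ne volume v)] with w hw hwv
        exact setLIntegral_kernelDensity_mul_le ha ha' hs hv.1 hw.1 hwv.symm
    _ ≤ ENNReal.ofReal (cH H ^ 2) * (ENNReal.ofReal (eulerBeta (1 - 2 * a) a) *
          ENNReal.ofReal (2 * (t - s) ^ (2 * a - 1 + 2) / ((2 * a - 1 + 1) * (2 * a - 1 + 2)))) := by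
        simp_rw [lintegral_const_mul' _ _ ENNReal.ofReal_ne_top]
        gcongr
        exact lintegral_lintegral_abs_sub_rpow_le (by linarith) hst
    _ = ENNReal.ofReal ((t - s) ^ (2 * H)) := by
        rw [← mul_assoc, ← ENNReal.ofReal_mul (sq_nonneg _), hc,
          ← ENNReal.ofReal_mul (mul_nonneg (by linarith) (by linarith)),
          show 2 * a - 1 + 2 = 2 * H by ring, show 2 * a - 1 + 1 = 2 * H - 1 by ring]
        have h1 : H ≠ 0 := by linarith
        have h2 : 2 * H - 1 ≠ 0 := by linarith
        generalize (t - s) ^ (2 * H) = x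
        congr 1
        rw [mul_div_assoc', div_eq_iff (by positivity)]
        ring
end

section
/- For all $0 \le s \le t$ one has $\int_s^t K_H(t,u)^2\,du \ge \dfrac{2\,c_H^2}{H(2H-1)^2}\,(t-s)^{2H}$. -/
open MeasureTheory Set

lemma intervalIntegrable_sub_left_rpow {r : ℝ} (hr : -1 < r) (a b c : ℝ) :
    IntervalIntegrable (fun v => (v - c) ^ r) volume a b := by
  simpa using (intervalIntegral.intervalIntegrable_rpow' (a := a - c) (b := b - c) hr).comp_sub_right c

lemma integral_sub_left_rpow {r : ℝ} (hr : -1 < r) (a b : ℝ) :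
    ∫ v in a..b, (v - a) ^ r = (b - a) ^ (r + 1) / (r + 1) := by
  rw [intervalIntegral.integral_comp_sub_right (fun x : ℝ => x ^ r), integral_rpow (Or.inl hr)]
  simp [Real.zero_rpow (by linarith : r + 1 ≠ 0)]

lemma integral_sub_right_rpow {r : ℝ} (hr : -1 < r) (a b : ℝ) :
    ∫ v in a..b, (b - v) ^ r = (b - a) ^ (r + 1) / (r + 1) := by
  rw [intervalIntegral.integral_comp_sub_left (fun x : ℝ => x ^ r), integral_rpow (Or.inl hr)]
  simp [Real.zero_rpow (by linarith : r + 1 ≠ 0)]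

lemma measurable_KH (H t : ℝ) : Measurable (KH H t) := by
  have hm : Measurable fun u : ℝ => ∫ v,
      {p : ℝ × ℝ | p.1 < p.2 ∧ p.2 ≤ t}.indicator
        (fun p => (p.2 - p.1) ^ (H - 3/2) * p.2 ^ (H - 1/2)) (u, v) := by
    refine StronglyMeasurable.measurable (StronglyMeasurable.integral_prod_right' ?_)
    refine (Measurable.indicator (by fun_prop) ?_).stronglyMeasurable
    exact (measurableSet_lt measurable_fst measurable_snd).inter
      (measurableSet_le measurable_snd measurable_const)
  have hK : KH H t = (Ioo 0 t).indicator fun u => cH H * u ^ ((1:ℝ)/2 - H) * ∫ v,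
      {p : ℝ × ℝ | p.1 < p.2 ∧ p.2 ≤ t}.indicator
        (fun p => (p.2 - p.1) ^ (H - 3/2) * p.2 ^ (H - 1/2)) (u, v) := by
    ext u
    by_cases hu : 0 < u ∧ u < t
    · rw [KH, if_pos hu, indicator_of_mem (show u ∈ Ioo 0 t from hu),
        intervalIntegral.integral_of_le hu.2.le, ← integral_indicator measurableSet_Ioc]
      rfl
    · rw [KH, if_neg hu, indicator_of_notMem (show u ∉ Ioo 0 t from hu)]
  rw [hK]
  exact Measurable.indicator (by fun_prop) measurableSet_Ioo

lemma intervalIntegrable_KH_integrand {H : ℝ} (hH : 1/2 < H) (u t : ℝ) :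
    IntervalIntegrable (fun v => (v - u) ^ (H - 3/2) * v ^ (H - 1/2)) volume u t :=
  (intervalIntegrable_sub_left_rpow (by linarith) u t u).mul_continuousOn
    (Real.continuous_rpow_const (by linarith)).continuousOn

lemma le_KH {H u t : ℝ} (hH : 1/2 < H) (hu : 0 < u) (hut : u < t) :
    cH H * ((t - u) ^ (H - 1/2) / (H - 1/2)) ≤ KH H t u := by
  rw [KH, if_pos ⟨hu, hut⟩, mul_assoc]
  refine mul_le_mul_of_nonneg_left ?_ (Real.sqrt_nonneg _)
  have h := integral_sub_left_rpow (r := H - 3/2) (by linarith) u t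
  rw [show H - 3/2 + 1 = H - 1/2 by ring] at h
  rw [← h, ← intervalIntegral.integral_const_mul]
  refine intervalIntegral.integral_mono_on hut.le
    (intervalIntegrable_sub_left_rpow (by linarith) u t u)
    ((intervalIntegrable_KH_integrand hH u t).const_mul _) fun v hv => ?_
  have h1 : 0 ≤ (v - u) ^ (H - 3/2) := Real.rpow_nonneg (by linarith [hv.1]) _
  have h2 : u ^ (H - 1/2) ≤ v ^ (H - 1/2) := Real.rpow_le_rpow hu.le hv.1 (by linarith)
  have h3 : u ^ ((1:ℝ)/2 - H) * u ^ (H - 1/2) = 1 := by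
    rw [← Real.rpow_add hu]; simp
  have h4 : 1 ≤ u ^ ((1:ℝ)/2 - H) * v ^ (H - 1/2) := by
    exact h3.ge.trans (mul_le_mul_of_nonneg_left h2 (Real.rpow_nonneg hu.le _))
  calc (v - u) ^ (H - 3/2) ≤ (v - u) ^ (H - 3/2) * (u ^ ((1:ℝ)/2 - H) * v ^ (H - 1/2)) :=
        le_mul_of_one_le_right h1 h4
    _ = _ := by ring

lemma KH_le {H u t : ℝ} (hH : 1/2 < H) (hu : 0 < u) (hut : u < t) :
    KH H t u ≤ cH H * (t ^ (H - 1/2) * (t ^ (H - 1/2) / (H - 1/2))) * u ^ ((1:ℝ)/2 - H) := by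
  rw [KH, if_pos ⟨hu, hut⟩, mul_right_comm]
  have hc : 0 ≤ cH H := Real.sqrt_nonneg _
  have h := integral_sub_left_rpow (r := H - 3/2) (by linarith) u t
  rw [show H - 3/2 + 1 = H - 1/2 by ring] at h
  have h1 : (∫ v in u..t, (v - u) ^ (H - 3/2) * v ^ (H - 1/2)) ≤
      t ^ (H - 1/2) * ((t - u) ^ (H - 1/2) / (H - 1/2)) := by
    rw [← h, ← intervalIntegral.integral_const_mul]
    refine intervalIntegral.integral_mono_on hut.le (intervalIntegrable_KH_integrand hH u t)
      ((intervalIntegrable_sub_left_rpow (by linarith) u t u).const_mul _) fun v hv => ?_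
    rw [mul_comm]
    exact mul_le_mul_of_nonneg_right
      (Real.rpow_le_rpow (hu.le.trans hv.1) hv.2 (by linarith))
      (Real.rpow_nonneg (by linarith [hv.1]) _)
  have h2 : (t - u) ^ (H - 1/2) ≤ t ^ (H - 1/2) :=
    Real.rpow_le_rpow (by linarith) (by linarith) (by linarith)
  have h3 : 0 ≤ t ^ (H - 1/2) := Real.rpow_nonneg (by linarith) _
  have h4 : 0 < H - 1/2 := by linarith
  refine mul_le_mul_of_nonneg_right (mul_le_mul_of_nonneg_left (h1.trans ?_) hc)
    (Real.rpow_nonneg hu.le _)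
  gcongr

lemma KH_nonneg {H u t : ℝ} (hH : 1/2 < H) : 0 ≤ KH H t u := by
  by_cases h : 0 < u ∧ u < t
  · refine le_trans ?_ (le_KH hH h.1 h.2)
    exact mul_nonneg (Real.sqrt_nonneg _)
      (div_nonneg (Real.rpow_nonneg (by linarith [h.2]) _) (by linarith))
  · rw [KH, if_neg h]

lemma intervalIntegrable_KH_sq {H s t : ℝ} (hH : H ∈ Ioo (1/2 : ℝ) 1) (hs : 0 ≤ s)
    (hst : s ≤ t) : IntervalIntegrable (fun u => (KH H t u) ^ 2) volume s t := by
  set C := cH H * (t ^ (H - 1/2) * (t ^ (H - 1/2) / (H - 1/2)))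
  have hg : IntervalIntegrable (fun u : ℝ => C ^ 2 * u ^ (1 - 2 * H)) volume s t :=
    (intervalIntegral.intervalIntegrable_rpow' (by linarith [hH.2])).const_mul _
  refine hg.mono_fun ((measurable_KH H t).pow_const 2).aestronglyMeasurable ?_
  rw [uIoc_of_le hst]
  refine (ae_restrict_iff' measurableSet_Ioc).2 (Filter.Eventually.of_forall fun u hu => ?_)
  have hu0 : 0 < u := hs.trans_lt hu.1
  have hr : 0 ≤ C ^ 2 * u ^ (1 - 2 * H) := mul_nonneg (sq_nonneg _) (Real.rpow_nonneg hu0.le _)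
  beta_reduce
  rw [Real.norm_of_nonneg (sq_nonneg _), Real.norm_of_nonneg hr]
  rcases hu.2.lt_or_eq with hut | rfl
  · calc (KH H t u) ^ 2 ≤ (C * u ^ ((1:ℝ)/2 - H)) ^ 2 :=
          pow_le_pow_left₀ (KH_nonneg hH.1) (KH_le hH.1 hu0 hut) 2
      _ = C ^ 2 * u ^ (1 - 2 * H) := by
          rw [mul_pow, ← Real.rpow_mul_natCast hu0.le]
          congr 2
          push_cast
          ring
  · simpa [KH] using hr

/-- For `0 ≤ s ≤ t`, one has `∫_s^t K_H(t,u)² du ≥ (2 c_H²/(H(2H-1)²)) (t-s)^(2H)`. -/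
theorem stmt_10 (H : ℝ) (hH : H ∈ Set.Ioo (1/2 : ℝ) 1) (s t : ℝ) (hs : 0 ≤ s) (hst : s ≤ t) :
    2 * (cH H)^2 / (H * (2*H - 1)^2) * (t - s) ^ (2*H) ≤ ∫ u in s..t, (KH H t u)^2 := by
  have hd : (0:ℝ) < H - 1/2 := by linarith [hH.1]
  have hH0 : H ≠ 0 := by linarith
  have hd' : 2 * H - 1 ≠ 0 := by linarith
  have hpow := integral_sub_right_rpow (r := 2 * H - 1) (by linarith) s t
  rw [show 2 * H - 1 + 1 = 2 * H by ring] at hpow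
  have hval : 2 * (cH H)^2 / (H * (2*H - 1)^2) * (t - s) ^ (2*H) =
      ∫ u in s..t, (cH H / (H - 1/2)) ^ 2 * (t - u) ^ (2 * H - 1) := by
    rw [intervalIntegral.integral_const_mul, hpow, show H - 1/2 = (2 * H - 1) / 2 by ring]
    field_simp
  rw [hval]
  refine intervalIntegral.integral_mono_on_of_le_Ioo hst ?_ (intervalIntegrable_KH_sq hH hs hst)
    fun u hu => ?_
  · refine ContinuousOn.intervalIntegrable (Continuous.continuousOn ?_)
    exact continuous_const.mul
      ((continuous_const.sub continuous_id).rpow_const fun _ => Or.inr (by linarith))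
  · have hut : 0 ≤ t - u := by linarith [hu.2]
    calc (cH H / (H - 1/2)) ^ 2 * (t - u) ^ (2 * H - 1)
        = (cH H * ((t - u) ^ (H - 1/2) / (H - 1/2))) ^ 2 := by
          rw [show 2 * H - 1 = (H - 1/2) * (2 : ℕ) by push_cast; ring,
            Real.rpow_mul_natCast hut]
          ring
      _ ≤ (KH H t u) ^ 2 := by
          refine pow_le_pow_left₀ ?_ (le_KH hH.1 (hs.trans_lt hu.1) hu.2) 2
          exact mul_nonneg (Real.sqrt_nonneg _) (div_nonneg (Real.rpow_nonneg hut _) hd.le)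
end
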